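/- Let d ≥ 1, α > 0, C ≥ 1, and suppose μ_j for j ∈ (ℕ_{>0})^d satisfies C^{-1}(∏_i j_i)^{-1-2α/d} ≤ μ_j ≤ C(∏_i j_i)^{-1-2α/d}. Let ν_j = Nμ_j/(σ² + Nμ_j) and J_α = (N/σ²)^{d/(2α+d)}. Then for every integer k ≥ 1 there exist constants (depending only on d, α, k, C) such that ∑_j ν_j^k ≍ J_α (log J_α)^{d-1}, provided N/σ² is sufficiently large. -/

import Mathlib

open Real

lemma aux_cons (m : ℕ) (G : (Fin (m+1) → ℕ+) → ENNReal) :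
    ∑' j, G j = ∑' j' : Fin m → ℕ+, ∑' n : ℕ+, G (Fin.cons n j') := by
  rw [← (Fin.consEquiv (fun _ : Fin (m+1) => ℕ+)).tsum_eq, ENNReal.tsum_prod', ENNReal.tsum_comm]
  rfl

lemma aux_pow (f : ℕ+ → ENNReal) (m : ℕ) :
    ∑' j : Fin m → ℕ+, ∏ i, f (j i) = (∑' n, f n) ^ m := by
  induction m with
  | zero => simp
  | succ m ih =>
    rw [aux_cons]
    simp only [Fin.prod_univ_succ, Fin.cons_zero, Fin.cons_succ]
    simp_rw [ENNReal.tsum_mul_right]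
    rw [ENNReal.tsum_mul_left, ih, pow_succ, mul_comm]

lemma aux_nat (f : ℕ+ → ENNReal) : ∑' n, f n = ∑' n : ℕ, f n.succPNat :=
  (Equiv.pnatEquivNat.symm.tsum_eq f).symm

lemma aux_tele (ε : ℝ) (hε : 0 < ε) (n : ℕ) :
    ε * (1 / ((n:ℝ) + 2)) ^ (1 + ε) ≤ ((n:ℝ)+1) ^ (-ε) - ((n:ℝ)+2) ^ (-ε) := by
  have h2 : (0:ℝ) < (n:ℝ) + 2 := by positivity
  have h1 : (0:ℝ) < (n:ℝ) + 1 := by positivity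
  have e1 : (1 / ((n:ℝ) + 2)) ^ (1 + ε) = ((n:ℝ)+2) ^ (-ε) * (1 / ((n:ℝ)+2)) := by
    rw [one_div, ← Real.rpow_neg_eq_inv_rpow, neg_add, add_comm (-1) (-ε), Real.rpow_add h2, Real.rpow_neg_one]
  have e2 : ((n:ℝ)+1) ^ (-ε) = ((n:ℝ)+2) ^ (-ε) * (((n:ℝ)+1)/((n:ℝ)+2)) ^ (-ε) := by
    rw [← Real.mul_rpow h2.le (by positivity)]
    congr 1; field_simp
  have hp : (0:ℝ) < ((n:ℝ)+1)/((n:ℝ)+2) := by positivity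
  have e3 : 1 + ε * (1 / ((n:ℝ)+2)) ≤ (((n:ℝ)+1)/((n:ℝ)+2)) ^ (-ε) := by
    rw [Real.rpow_def_of_pos hp]
    have a1 := Real.add_one_le_exp (Real.log (((n:ℝ)+1)/((n:ℝ)+2)) * -ε)
    have a2 := Real.log_le_sub_one_of_pos hp
    have a3 : ((n:ℝ)+1)/((n:ℝ)+2) - 1 = - (1 / ((n:ℝ)+2)) := by field_simp; ring
    rw [a3] at a2
    nlinarith
  rw [e1, e2]
  have : 0 < ((n:ℝ)+2) ^ (-ε) := by positivity
  nlinarith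

lemma aux_zeta_sum (ε : ℝ) (hε : 0 < ε) (n : ℕ) :
    ∑ i ∈ Finset.range (n+1), (1 / ((i:ℝ) + 1)) ^ (1 + ε) ≤
      1 + 1 / ε * (1 - ((n:ℝ)+1) ^ (-ε)) := by
  induction n with
  | zero => simp
  | succ n ih =>
    rw [Finset.sum_range_succ]
    have h := aux_tele ε hε n
    have h' : (1 / ((n:ℝ) + 2)) ^ (1 + ε) ≤ 1 / ε * (((n:ℝ)+1) ^ (-ε) - ((n:ℝ)+2) ^ (-ε)) := by
      rw [one_div_mul_eq_div, le_div_iff₀ hε]; linarith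
    push_cast
    rw [show (n:ℝ) + 1 + 1 = n + 2 by ring]
    linarith

lemma aux_zeta (ε : ℝ) (hε : 0 < ε) (hε1 : ε ≤ 1) :
    ∑' n : ℕ+, ENNReal.ofReal ((1 / ((n:ℕ):ℝ)) ^ (1 + ε)) ≤ ENNReal.ofReal (2 / ε) := by
  rw [aux_nat]
  refine ENNReal.tsum_le_of_sum_range_le fun n => ?_
  rw [← ENNReal.ofReal_sum_of_nonneg (fun i _ => by positivity)]
  apply ENNReal.ofReal_le_ofReal
  have h := aux_zeta_sum ε hε n
  rw [Finset.sum_range_succ] at h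
  have h0 : 0 ≤ (1 / ((n:ℝ) + 1)) ^ (1 + ε) := by positivity
  have h3 : 1 / ε * (1 - ((n:ℝ)+1) ^ (-ε)) ≤ 1 / ε := by
    have : 0 ≤ ((n:ℝ)+1) ^ (-ε) := by positivity
    have : 0 < 1 / ε := by positivity
    nlinarith
  have h4 : 1 ≤ 1 / ε := by rw [le_div_iff₀ hε]; linarith
  have h5 : 2 / ε = 1 / ε + 1 / ε := by ring
  simp only [Nat.succPNat_coe, Nat.succ_eq_add_one, Nat.cast_add, Nat.cast_one]
  linarith

/-- one-dimensional bound -/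
lemma aux_one (s : ℝ) (hs : 1 < s) : ∃ A > (0:ℝ), ∀ U > (0:ℝ), ∀ ε > (0:ℝ), ε ≤ s - 1 →
    ∑' n : ℕ+, ENNReal.ofReal ((min 1 (U / ((n:ℕ):ℝ))) ^ s) ≤ ENNReal.ofReal (A * U ^ (1 + ε)) := by
  have hsum : Summable (fun q : ℕ => (1 / ((q:ℝ) + 1)) ^ s) := by
    have := (summable_nat_add_iff 1).2 (Real.summable_one_div_nat_rpow.2 hs)
    refine this.congr fun q => ?_
    rw [Real.div_rpow (by positivity) (by positivity)]; simp
  set Z := ∑' q : ℕ, (1 / ((q:ℝ) + 1)) ^ s with hZ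
  have hZ1 : 1 ≤ Z := by
    have := hsum.le_tsum 0 (fun i _ => by positivity)
    simpa [hZ] using this
  have hZE : ∑' q : ℕ, ENNReal.ofReal ((1 / ((q:ℝ) + 1)) ^ s) = ENNReal.ofReal Z :=
    (ENNReal.ofReal_tsum_of_nonneg (fun _ => by positivity) hsum).symm
  have h2s : (1:ℝ) ≤ 2 ^ s := Real.one_le_rpow (by norm_num) (by linarith)
  refine ⟨2 * 2 ^ s * Z, by positivity, fun U hU ε hε hεs => ?_⟩
  rw [aux_nat]
  simp only [Nat.succPNat_coe, Nat.succ_eq_add_one, Nat.cast_add, Nat.cast_one]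
  rcases le_or_gt 1 U with h1 | h1
  · set m := ⌈U⌉₊ with hm
    have hm0 : 0 < m := Nat.ceil_pos.2 hU
    have : NeZero m := ⟨hm0.ne'⟩
    have hUm : U ≤ m := Nat.le_ceil U
    have hm2 : (m:ℝ) ≤ 2 * U := by
      have := Nat.ceil_lt_add_one hU.le
      linarith
    rw [← (Nat.divModEquiv m).symm.tsum_eq, ENNReal.tsum_prod']
    have key : ∀ q : ℕ, ∀ r : Fin m,
        ENNReal.ofReal ((min 1 (U / (((Nat.divModEquiv m).symm (q, r) : ℕ) + 1 : ℝ))) ^ s) ≤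
        ENNReal.ofReal (2 ^ s) * ENNReal.ofReal ((1 / ((q:ℝ) + 1)) ^ s) := by
      intro q r
      rw [← ENNReal.ofReal_mul (by positivity), ← Real.mul_rpow (by positivity) (by positivity)]
      apply ENNReal.ofReal_le_ofReal
      apply Real.rpow_le_rpow (by positivity) _ (by linarith)
      rcases Nat.eq_zero_or_pos q with rfl | hq
      · refine (min_le_left _ _).trans (by norm_num)
      · refine (min_le_right _ _).trans ?_
        simp only [Nat.divModEquiv_symm_apply]
        push_cast
        have hq1 : (1:ℝ) ≤ q := by exact_mod_cast hq
        rw [mul_one_div, div_le_div_iff₀ (by positivity) (by positivity)]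
        have : (0:ℝ) ≤ ((r:ℕ):ℝ) := by positivity
        nlinarith [mul_le_mul_of_nonneg_left hUm (by linarith : (0:ℝ) ≤ q)]
    calc _ ≤ ∑' q : ℕ, ∑' r : Fin m, ENNReal.ofReal (2 ^ s) * ENNReal.ofReal ((1 / ((q:ℝ) + 1)) ^ s) :=
          ENNReal.tsum_le_tsum fun q => ENNReal.tsum_le_tsum fun r => key q r
      _ = (m : ENNReal) * (ENNReal.ofReal (2 ^ s) * ENNReal.ofReal Z) := by
          simp only [tsum_fintype, Finset.sum_const, Finset.card_univ, Fintype.card_fin, nsmul_eq_mul]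
          rw [ENNReal.tsum_mul_left, ENNReal.tsum_mul_left, hZE]
      _ = ENNReal.ofReal (m * (2 ^ s * Z)) := by
          rw [ENNReal.ofReal_mul (by positivity), ENNReal.ofReal_mul (by positivity), ENNReal.ofReal_natCast]
      _ ≤ _ := by
          apply ENNReal.ofReal_le_ofReal
          have : U ≤ U ^ (1 + ε) := by
            conv_lhs => rw [← Real.rpow_one U]
            exact Real.rpow_le_rpow_of_exponent_le h1 (by linarith)
          have h3 : 0 < 2 ^ s * Z := by positivity
          nlinarith
  · calc _ ≤ ∑' q : ℕ, ENNReal.ofReal (U ^ s) * ENNReal.ofReal ((1 / ((q:ℝ) + 1)) ^ s) := by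
          refine ENNReal.tsum_le_tsum fun q => ?_
          rw [← ENNReal.ofReal_mul (by positivity), ← Real.mul_rpow (by positivity) (by positivity), mul_one_div]
          apply ENNReal.ofReal_le_ofReal
          exact Real.rpow_le_rpow (by positivity) (min_le_right _ _) (by linarith)
      _ = ENNReal.ofReal (U ^ s * Z) := by
          rw [ENNReal.tsum_mul_left, hZE, ENNReal.ofReal_mul (by positivity)]
      _ ≤ _ := by
          apply ENNReal.ofReal_le_ofReal
          have : U ^ s ≤ U ^ (1 + ε) := Real.rpow_le_rpow_of_exponent_ge hU h1.le (by linarith)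
          have h3 : 0 < U ^ (1 + ε) := by positivity
          calc U ^ s * Z ≤ U ^ (1+ε) * Z := by gcongr
            _ ≤ (2 * 2 ^ s) * (U ^ (1+ε) * Z) := le_mul_of_one_le_left (by positivity) (by linarith)
            _ = _ := by ring

lemma aux_upper (m : ℕ) (s : ℝ) (hs : 1 < s) : ∃ B > (0:ℝ), ∀ T > (0:ℝ),
    1 + 1 / (s - 1) ≤ Real.log T →
    ∑' j : Fin (m+1) → ℕ+, ENNReal.ofReal ((min 1 (T / ∏ i, ((j i : ℕ) : ℝ))) ^ s) ≤
      ENNReal.ofReal (B * T * Real.log T ^ m) := by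
  obtain ⟨A, hA, h⟩ := aux_one s hs
  refine ⟨A * Real.exp 1 * 2 ^ m, by positivity, fun T hT hlog => ?_⟩
  have hs1 : 0 < s - 1 := by linarith
  have hpos : 0 < 1 / (s - 1) := by positivity
  have hL : 0 < Real.log T := by linarith
  set ε := 1 / Real.log T with hε
  have hε0 : 0 < ε := by positivity
  have hε1 : ε ≤ 1 := by rw [hε, div_le_one hL]; linarith
  have hεs : ε ≤ s - 1 := by
    rw [hε, div_le_iff₀ hL]
    have : (s - 1) * (1 / (s-1)) = 1 := by field_simp
    nlinarith
  have hTε : T ^ (1 + ε) = T * Real.exp 1 := by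
    rw [Real.rpow_add hT, Real.rpow_one, Real.rpow_def_of_pos hT, hε, mul_one_div_cancel hL.ne']
  rw [aux_cons]
  calc _ = ∑' j' : Fin m → ℕ+, ∑' n : ℕ+, ENNReal.ofReal
            ((min 1 ((T / ∏ i, ((j' i : ℕ) : ℝ)) / ((n:ℕ):ℝ))) ^ s) := by
          refine tsum_congr fun j' => tsum_congr fun n => ?_
          simp only [Fin.prod_univ_succ, Fin.cons_zero, Fin.cons_succ]
          rw [div_div, mul_comm]
    _ ≤ ∑' j' : Fin m → ℕ+, ENNReal.ofReal (A * (T / ∏ i, ((j' i : ℕ) : ℝ)) ^ (1 + ε)) := by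
          refine ENNReal.tsum_le_tsum fun j' => h _ ?_ ε hε0 hεs
          have : 0 < ∏ i, ((j' i : ℕ) : ℝ) := Finset.prod_pos fun i _ => by exact_mod_cast (j' i).pos
          positivity
    _ = ∑' j' : Fin m → ℕ+, ENNReal.ofReal (A * (T * Real.exp 1)) *
          ∏ i, ENNReal.ofReal ((1 / ((j' i : ℕ) : ℝ)) ^ (1 + ε)) := by
          refine tsum_congr fun j' => ?_
          rw [← ENNReal.ofReal_prod_of_nonneg (fun i _ => by positivity),
            ← ENNReal.ofReal_mul (by positivity), Real.finsetProd_rpow _ _ (fun i _ => by positivity),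
            ← hTε, mul_assoc, ← Real.mul_rpow hT.le (Finset.prod_nonneg fun i _ => by positivity)]
          simp [div_eq_mul_inv]
    _ ≤ ENNReal.ofReal (A * (T * Real.exp 1)) * ENNReal.ofReal (2 / ε) ^ m := by
          rw [ENNReal.tsum_mul_left, aux_pow (fun n => ENNReal.ofReal ((1 / ((n : ℕ) : ℝ)) ^ (1 + ε)))]
          gcongr
          exact aux_zeta ε hε0 hε1
    _ = _ := by
          rw [← ENNReal.ofReal_pow (by positivity), ← ENNReal.ofReal_mul (by positivity)]
          congr 1
          rw [hε, div_div_eq_mul_div, div_one, mul_pow]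
          ring

lemma aux_lower (m : ℕ) (T : ℝ) (hT : 1 ≤ T) :
    ENNReal.ofReal ((1 / 2 * (1 / ((m:ℝ)+1)) ^ m) * T * Real.log T ^ m) ≤
    ∑' j : Fin (m+1) → ℕ+, (if ∏ i, ((j i : ℕ) : ℝ) ≤ T then (1:ENNReal) else 0) := by
  have hT0 : 0 < T := by linarith
  set Y := T ^ (1 / ((m:ℝ)+1)) with hY
  have hY1 : 1 ≤ Y := Real.one_le_rpow hT (by positivity)
  have hYT : Y ^ m ≤ T := by
    calc Y ^ m ≤ Y ^ (m+1) := pow_le_pow_right₀ hY1 (by omega)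
      _ = T := by
        rw [hY, ← Real.rpow_natCast, ← Real.rpow_mul hT0.le]
        push_cast
        rw [one_div_mul_cancel (by positivity), Real.rpow_one]
  have hlogY : Real.log Y = 1 / ((m:ℝ)+1) * Real.log T := Real.log_rpow hT0 _
  have hlogT : 0 ≤ Real.log T := Real.log_nonneg hT
  let g : ℕ+ → ENNReal := fun n => if ((n:ℕ):ℝ) ≤ Y then ENNReal.ofReal (1 / ((n:ℕ):ℝ)) else 0
  have hg : ENNReal.ofReal (Real.log Y) ≤ ∑' n, g n := by
    have h1 := log_le_harmonic_floor Y (by linarith)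
    rw [aux_nat]
    refine le_trans ?_ (ENNReal.sum_le_tsum (Finset.range ⌊Y⌋₊))
    calc ENNReal.ofReal (Real.log Y) ≤ ENNReal.ofReal (harmonic ⌊Y⌋₊ : ℝ) := ENNReal.ofReal_le_ofReal h1
      _ = ∑ i ∈ Finset.range ⌊Y⌋₊, ENNReal.ofReal (1 / ((i:ℝ)+1)) := by
        rw [← ENNReal.ofReal_sum_of_nonneg (fun i _ => by positivity)]
        simp [harmonic]
      _ ≤ _ := by
        refine Finset.sum_le_sum fun i hi => ?_
        have : ((i:ℝ) + 1) ≤ Y := by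
          have := (Nat.le_floor_iff (by linarith : 0 ≤ Y)).1 (Finset.mem_range.1 hi)
          push_cast at this; exact this
        simp only [g, Nat.succPNat_coe, Nat.succ_eq_add_one, Nat.cast_add, Nat.cast_one, if_pos this, le_refl]
  have hcount : ∀ V : ℝ, 1 ≤ V → ENNReal.ofReal (V / 2) ≤
      ∑' n : ℕ+, (if ((n:ℕ):ℝ) ≤ V then (1:ENNReal) else 0) := by
    intro V hV
    rw [aux_nat]
    refine le_trans ?_ (ENNReal.sum_le_tsum (Finset.range ⌊V⌋₊))
    calc ENNReal.ofReal (V / 2) ≤ ENNReal.ofReal (⌊V⌋₊ : ℝ) := by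
          apply ENNReal.ofReal_le_ofReal
          have h1 := Nat.lt_floor_add_one V
          have h2 : (1:ℝ) ≤ ⌊V⌋₊ := by exact_mod_cast (Nat.one_le_floor_iff V).2 hV
          linarith
      _ = ∑ i ∈ Finset.range ⌊V⌋₊, (1:ENNReal) := by simp
      _ ≤ _ := by
        refine Finset.sum_le_sum fun i hi => ?_
        have : ((i:ℝ) + 1) ≤ V := by
          have := (Nat.le_floor_iff (by linarith : 0 ≤ V)).1 (Finset.mem_range.1 hi)
          push_cast at this; exact this
        simp [this]
  rw [aux_cons]
  calc _ = ENNReal.ofReal (T / 2) * ENNReal.ofReal (Real.log Y) ^ m := by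
          rw [← ENNReal.ofReal_pow (by rw [hlogY]; positivity), ← ENNReal.ofReal_mul (by positivity), hlogY, mul_pow]
          congr 1; ring
    _ ≤ ENNReal.ofReal (T / 2) * (∑' n, g n) ^ m := by gcongr
    _ = ∑' j' : Fin m → ℕ+, ENNReal.ofReal (T / 2) * ∏ i, g (j' i) := by
          rw [ENNReal.tsum_mul_left, aux_pow]
    _ ≤ _ := by
          refine ENNReal.tsum_le_tsum fun j' => ?_
          have hp : 0 < ∏ i, ((j' i : ℕ) : ℝ) := Finset.prod_pos fun i _ => by exact_mod_cast (j' i).pos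
          by_cases hall : ∀ i, ((j' i : ℕ) : ℝ) ≤ Y
          · have hpT : ∏ i, ((j' i : ℕ) : ℝ) ≤ T := by
              refine le_trans ?_ hYT
              calc _ ≤ ∏ i : Fin m, Y := Finset.prod_le_prod (fun i _ => by positivity) (fun i _ => hall i)
                _ = Y ^ m := by simp
            have h1 := hcount (T / ∏ i, ((j' i : ℕ) : ℝ)) (by rw [le_div_iff₀ hp]; linarith)
            refine le_trans (le_of_eq ?_) (h1.trans (le_of_eq ?_))
            · have : ∏ i, g (j' i) = ∏ i, ENNReal.ofReal (1 / ((j' i:ℕ):ℝ)) :=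
                Finset.prod_congr rfl fun i _ => by simp only [g, if_pos (hall i)]
              rw [this, ← ENNReal.ofReal_prod_of_nonneg (fun i _ => by positivity),
                ← ENNReal.ofReal_mul (by positivity)]
              congr 1
              simp [div_eq_mul_inv]; ring
            · refine tsum_congr fun n => ?_
              simp only [Fin.prod_univ_succ, Fin.cons_zero, Fin.cons_succ, le_div_iff₀ hp]
          · push Not at hall
            obtain ⟨i, hi⟩ := hall
            have : ∏ i, g (j' i) = 0 := Finset.prod_eq_zero (Finset.mem_univ i) (by simp [g, hi])
            rw [this]; simp

/-- For polynomially decaying eigenvalues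
`μ_j ≍ (∏ j_i)^{-1-2α/d}` and `ν_j = Nμ_j/(σ²+Nμ_j)`, for each `k ≥ 1`,
`∑_j ν_j^k ≍ J_α (log J_α)^{d-1}` with `J_α = (N/σ²)^{d/(2α+d)}`, for `N/σ²` large. -/
theorem nu_sum_polynomial (d k : ℕ) (hd : 1 ≤ d) (hk : 1 ≤ k)
    (α C : ℝ) (hα : 0 < α) (hC : 1 ≤ C) :
    ∃ c₁ > (0:ℝ), ∃ c₂ > (0:ℝ), ∃ T₀ : ℝ, ∀ μ : (Fin d → ℕ+) → ℝ,
      (∀ j, C⁻¹ * (∏ i, ((j i : ℕ) : ℝ)) ^ (-1 - 2 * α / d) ≤ μ j ∧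
            μ j ≤ C * (∏ i, ((j i : ℕ) : ℝ)) ^ (-1 - 2 * α / d)) →
      ∀ N σsq : ℝ, 0 < σsq → T₀ ≤ N / σsq →
      (c₁ * (N / σsq) ^ ((d : ℝ) / (2 * α + d)) *
          (Real.log ((N / σsq) ^ ((d : ℝ) / (2 * α + d)))) ^ (d - 1)
        ≤ ∑' j, (N * μ j / (σsq + N * μ j)) ^ k) ∧
      (∑' j, (N * μ j / (σsq + N * μ j)) ^ k
        ≤ c₂ * (N / σsq) ^ ((d : ℝ) / (2 * α + d)) *
            (Real.log ((N / σsq) ^ ((d : ℝ) / (2 * α + d)))) ^ (d - 1)) := by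
  obtain ⟨m, rfl⟩ : ∃ m, d = m + 1 := ⟨d - 1, by omega⟩
  set D : ℝ := ((m + 1 : ℕ) : ℝ) with hD
  have hD0 : 0 < D := by rw [hD]; positivity
  set s : ℝ := 1 + 2 * α / D with hs
  have hs1 : 1 < s := by
    have : 0 < 2 * α / D := by positivity
    linarith
  have hs0 : 0 < s := by linarith
  have hexp : -1 - 2 * α / D = -s := by rw [hs]; ring
  have hexp2 : D / (2 * α + D) = 1 / s := by rw [hs]; field_simp; ring
  rw [hexp, hexp2, Nat.add_sub_cancel]
  obtain ⟨B, hB, hup⟩ := aux_upper m s hs1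
  have hC0 : 0 < C := by linarith
  refine ⟨(1 / (1 + C)) ^ k * (1 / 2 * (1 / ((m:ℝ)+1)) ^ m), by positivity, C * B, by positivity,
    Real.exp (s * (1 + 1 / (s - 1))), ?_⟩
  intro μ hμ N σsq hσ hX
  set X := N / σsq with hXdef
  have hX0 : 0 < X := lt_of_lt_of_le (Real.exp_pos _) hX
  have hN : N = X * σsq := by rw [hXdef]; field_simp
  set T := X ^ (1 / s) with hT
  have hT0 : 0 < T := by positivity
  have hTs : T ^ s = X := by
    rw [hT, ← Real.rpow_mul hX0.le, one_div_mul_cancel hs0.ne', Real.rpow_one]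
  have hlog : 1 + 1 / (s - 1) ≤ Real.log T := by
    rw [hT, Real.log_rpow hX0, one_div_mul_eq_div, le_div_iff₀ hs0, Real.le_log_iff_exp_le hX0, mul_comm]
    exact hX
  have hpos : 0 < 1 / (s - 1) := by
    have : 0 < s - 1 := by linarith
    positivity
  have hlog0 : 0 < Real.log T := by linarith
  have hT1 : 1 ≤ T := ((Real.log_pos_iff hT0.le).1 hlog0).le
  -- pointwise facts
  have hp1 : ∀ j : Fin (m+1) → ℕ+, 0 < ∏ i, ((j i : ℕ) : ℝ) := fun j =>
    Finset.prod_pos fun i _ => by exact_mod_cast (j i).pos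
  have hXp : ∀ j : Fin (m+1) → ℕ+, X * (∏ i, ((j i : ℕ) : ℝ)) ^ (-s) =
      (T / ∏ i, ((j i : ℕ) : ℝ)) ^ s := fun j => by
    rw [Real.div_rpow hT0.le (hp1 j).le, hTs, Real.rpow_neg (hp1 j).le, div_eq_mul_inv]
  have hν : ∀ j, N * μ j / (σsq + N * μ j) = X * μ j / (1 + X * μ j) := fun j => by
    rw [hN, show σsq + X * σsq * μ j = σsq * (1 + X * μ j) by ring,
      show X * σsq * μ j = σsq * (X * μ j) by ring, mul_div_mul_left _ _ hσ.ne']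
  have hlo : ∀ j, C⁻¹ * (T / ∏ i, ((j i : ℕ) : ℝ)) ^ s ≤ X * μ j := fun j => by
    rw [← hXp]
    have := mul_le_mul_of_nonneg_left (hμ j).1 hX0.le
    linarith
  have hhi : ∀ j, X * μ j ≤ C * (T / ∏ i, ((j i : ℕ) : ℝ)) ^ s := fun j => by
    rw [← hXp]
    have := mul_le_mul_of_nonneg_left (hμ j).2 hX0.le
    linarith
  have hXμ : ∀ j, 0 < X * μ j := fun j => lt_of_lt_of_le (by have := hp1 j; positivity) (hlo j)
  have hν0 : ∀ j, 0 ≤ X * μ j / (1 + X * μ j) := fun j => by have := hXμ j; positivity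
  have hν1 : ∀ j, X * μ j / (1 + X * μ j) ≤ 1 := fun j => by
    have := hXμ j
    rw [div_le_one (by positivity)]; linarith
  simp_rw [hν]
  have hU : ∑' j, ENNReal.ofReal ((X * μ j / (1 + X * μ j)) ^ k) ≤
      ENNReal.ofReal (C * B * T * Real.log T ^ m) := by
    calc _ ≤ ∑' j : Fin (m+1) → ℕ+, ENNReal.ofReal C *
            ENNReal.ofReal ((min 1 (T / ∏ i, ((j i : ℕ) : ℝ))) ^ s) := by
          refine ENNReal.tsum_le_tsum fun j => ?_
          rw [← ENNReal.ofReal_mul hC0.le]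
          apply ENNReal.ofReal_le_ofReal
          refine (pow_le_of_le_one (hν0 j) (hν1 j) (by omega)).trans ?_
          rcases le_total 1 (T / ∏ i, ((j i : ℕ) : ℝ)) with h | h
          · rw [min_eq_left h, Real.one_rpow, mul_one]
            exact (hν1 j).trans hC
          · rw [min_eq_right h]
            refine le_trans ?_ (hhi j)
            have := hXμ j
            exact div_le_self this.le (by linarith)
      _ ≤ ENNReal.ofReal C * ENNReal.ofReal (B * T * Real.log T ^ m) := by
          rw [ENNReal.tsum_mul_left]
          gcongr
          exact hup T hT0 hlog
      _ = _ := by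
          rw [← ENNReal.ofReal_mul hC0.le]
          congr 1; ring
  have hL : ENNReal.ofReal ((1 / (1 + C)) ^ k * (1 / 2 * (1 / ((m:ℝ)+1)) ^ m) * T * Real.log T ^ m) ≤
      ∑' j, ENNReal.ofReal ((X * μ j / (1 + X * μ j)) ^ k) := by
    calc _ = ENNReal.ofReal ((1 / (1 + C)) ^ k) *
            ENNReal.ofReal ((1 / 2 * (1 / ((m:ℝ)+1)) ^ m) * T * Real.log T ^ m) := by
          rw [← ENNReal.ofReal_mul (by positivity)]
          congr 1; ring
      _ ≤ ENNReal.ofReal ((1 / (1 + C)) ^ k) *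
          ∑' j : Fin (m+1) → ℕ+, (if ∏ i, ((j i : ℕ) : ℝ) ≤ T then (1:ENNReal) else 0) := by
          gcongr
          exact aux_lower m T hT1
      _ ≤ _ := by
          rw [← ENNReal.tsum_mul_left]
          refine ENNReal.tsum_le_tsum fun j => ?_
          split_ifs with h
          · rw [mul_one]
            apply ENNReal.ofReal_le_ofReal
            refine pow_le_pow_left₀ (by positivity) ?_ k
            have h1 : 1 ≤ (T / ∏ i, ((j i : ℕ) : ℝ)) ^ s :=
              Real.one_le_rpow (by rw [le_div_iff₀ (hp1 j)]; linarith) hs0.le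
            have h2 : C⁻¹ ≤ X * μ j :=
              le_trans (le_mul_of_one_le_right (by positivity) h1) (hlo j)
            have h3 := hXμ j
            rw [div_le_div_iff₀ (by positivity) (by positivity)]
            have h4 : 1 ≤ C * (X * μ j) := by
              have := mul_le_mul_of_nonneg_left h2 hC0.le
              rwa [mul_inv_cancel₀ hC0.ne'] at this
            linarith
          · simp
  have hfin : ∑' j, ENNReal.ofReal ((X * μ j / (1 + X * μ j)) ^ k) ≠ ⊤ :=
    ne_top_of_le_ne_top ENNReal.ofReal_ne_top hU
  have heq : ∑' j, (X * μ j / (1 + X * μ j)) ^ k =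
      (∑' j, ENNReal.ofReal ((X * μ j / (1 + X * μ j)) ^ k)).toReal := by
    rw [ENNReal.tsum_toReal_eq (fun _ => ENNReal.ofReal_ne_top)]
    exact tsum_congr fun j => (ENNReal.toReal_ofReal (pow_nonneg (hν0 j) k)).symm
  rw [heq]
  constructor
  · exact (ENNReal.ofReal_le_iff_le_toReal hfin).1 hL
  · exact ENNReal.toReal_le_of_le_ofReal (by positivity) hU
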